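/- arXiv:1012.5553 — 5 statements merged into one kernel-verified Lean document; each statement's English description precedes it below -/
import Mathlib

section
/- (Minkowski's shortest-vector bound.) Let n ≥ 1 and let F be an invertible n×n real matrix. Then there exists a nonzero integer vector i ∈ ℤ^n \ {0} such that ‖F·i‖ ≤ (2^n / β_n)^{1/n} · |det F|^{1/n}, where ‖·‖ is the Euclidean norm and β_n is the Lebesgue volume of the unit Euclidean ball in ℝ^n. -/
open MeasureTheory

/-- If `R` satisfies `2 ^ n * |det F| ≤ vol (closedBall 0 R)`, then some nonzero integer vector is
mapped by `F` into the Euclidean ball of radius `R`. -/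
theorem exists_int_vec_sqrt_sum_sq_mulVec_le {n : ℕ} [NeZero n] (F : Matrix (Fin n) (Fin n) ℝ)
    (hF : F.det ≠ 0) (R : ℝ) (hR : ENNReal.ofReal |F.det| * 2 ^ n ≤
      volume (Metric.closedBall (0 : EuclideanSpace ℝ (Fin n)) R)) :
    ∃ i : Fin n → ℤ, i ≠ 0 ∧
      Real.sqrt (∑ k, (F.mulVec (fun j => (i j : ℝ)) k) ^ 2) ≤ R := by
  have hdet : LinearMap.det (Matrix.toLin' F) ≠ 0 := by rwa [LinearMap.det_toLin']
  let e : (Fin n → ℝ) ≃L[ℝ] EuclideanSpace ℝ (Fin n) :=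
    (LinearMap.equivOfDetNeZero (Matrix.toLin' F) hdet).toContinuousLinearEquiv.trans
      (EuclideanSpace.equiv (Fin n) ℝ).symm
  have he (x : Fin n → ℝ) : e x = WithLp.toLp 2 (F.mulVec x) := rfl
  let s : Set (Fin n → ℝ) := e ⁻¹' Metric.closedBall 0 R
  let b := Pi.basisFun ℝ (Fin n)
  have hvol : volume s = ENNReal.ofReal |F.det|⁻¹ *
      volume (Metric.closedBall (0 : EuclideanSpace ℝ (Fin n)) R) := by
    have h := Measure.addHaar_preimage_linearMap volume hdet
      (WithLp.toLp 2 ⁻¹' Metric.closedBall (0 : EuclideanSpace ℝ (Fin n)) R)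
    rw [(PiLp.volume_preserving_toLp (Fin n)).measure_preimage
      measurableSet_closedBall.nullMeasurableSet, LinearMap.det_toLin', abs_inv] at h
    exact h
  have hfund : volume (ZSpan.fundamentalDomain b) = 1 := by
    simp [b, ZSpan.fundamentalDomain_pi_basisFun, volume_pi]
  have hle : volume (ZSpan.fundamentalDomain b) * 2 ^ Module.finrank ℝ (Fin n → ℝ) ≤ volume s := by
    rw [hfund, hvol, one_mul, Module.finrank_fin_fun]
    calc (2 : ENNReal) ^ n
        = ENNReal.ofReal |F.det|⁻¹ * (ENNReal.ofReal |F.det| * 2 ^ n) := by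
          rw [← mul_assoc, ← ENNReal.ofReal_mul (by positivity),
            inv_mul_cancel₀ (abs_ne_zero.mpr hF), ENNReal.ofReal_one, one_mul]
      _ ≤ _ := by gcongr
  have : Countable (Submodule.span ℤ (Set.range b)).toAddSubgroup :=
    inferInstanceAs (Countable (Submodule.span ℤ (Set.range b)))
  have : DiscreteTopology (Submodule.span ℤ (Set.range b)).toAddSubgroup :=
    inferInstanceAs (DiscreteTopology (Submodule.span ℤ (Set.range b)))
  obtain ⟨⟨x, hxL⟩, hx0, hxs⟩ := exists_ne_zero_mem_lattice_of_measure_mul_two_pow_le_measure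
    (ZSpan.isAddFundamentalDomain' b volume) (s := s)
    (fun x hx => by simpa [s] using hx)
    ((convex_closedBall _ _).linear_preimage e.toLinearEquiv.toLinearMap)
    (e.toHomeomorph.isCompact_preimage.mpr (isCompact_closedBall _ _)) hle
  choose i hi using (b.mem_span_iff_repr_mem ℤ x).mp hxL
  have hix : (fun j => (i j : ℝ)) = x := by
    ext j
    simpa [b] using hi j
  refine ⟨i, ?_, ?_⟩
  · rintro rfl
    exact hx0 (Subtype.ext (by simpa [funext_iff, eq_comm] using hix))
  · rw [hix]
    simpa [s, he, EuclideanSpace.norm_eq] using hxs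

/-- Minkowski's shortest-vector bound: for an invertible real `n×n`
matrix `F` there is a nonzero integer vector `i` with
`‖F·i‖ ≤ (2^n / β_n)^{1/n} · |det F|^{1/n}`, where `β_n` is the volume of the
unit Euclidean ball in `ℝ^n`. -/
theorem minkowski_shortest_vector_bound
    (n : ℕ) (hn : 1 ≤ n) (F : Matrix (Fin n) (Fin n) ℝ) (hF : IsUnit F.det) :
    ∃ i : Fin n → ℤ, i ≠ 0 ∧
      Real.sqrt (∑ k, (F.mulVec (fun j => (i j : ℝ)) k) ^ 2) ≤
        ((2 : ℝ) ^ n /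
            (volume (Metric.closedBall (0 : EuclideanSpace ℝ (Fin n)) 1)).toReal) ^ ((n : ℝ)⁻¹) *
          |F.det| ^ ((n : ℝ)⁻¹) := by
  have : NeZero n := ⟨by omega⟩
  have hn0 : (n : ℝ) ≠ 0 := NeZero.ne _
  set B := volume (Metric.closedBall (0 : EuclideanSpace ℝ (Fin n)) 1) with hB
  have hBtop : B ≠ ⊤ := measure_closedBall_lt_top.ne
  have hBpos : 0 < B.toReal :=
    ENNReal.toReal_pos (Metric.measure_closedBall_pos _ _ one_pos).ne' hBtop
  refine exists_int_vec_sqrt_sum_sq_mulVec_le F hF.ne_zero _ ?_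
  rw [Measure.addHaar_closedBall' _ _ (by positivity), finrank_euclideanSpace_fin, ← hB, mul_pow,
    ← Real.rpow_mul_natCast (by positivity), ← Real.rpow_mul_natCast (by positivity),
    inv_mul_cancel₀ hn0, Real.rpow_one, Real.rpow_one, ← ENNReal.ofReal_toReal hBtop,
    ← ENNReal.ofReal_mul (by positivity)]
  rw [ENNReal.toReal_ofReal hBpos.le]
  apply le_of_eq
  rw [show (2 : ENNReal) ^ n = ENNReal.ofReal (2 ^ n) by simp [ENNReal.ofReal_pow],
    ← ENNReal.ofReal_mul (by positivity)]
  congr 1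
  field_simp
end

section
/- For every integer n ≥ 1, the volume β_n of the unit Euclidean ball in ℝ^n satisfies β_n > (2πe/n)^{n/2} · (1.4 π n)^{−1/2}. -/
open MeasureTheory Real

/-- The recursion `Γ(x + 2) = (x + 1) Γ(x + 1)` preserves a Stirling-type upper bound on
`Γ(x + 1)` with an arbitrary constant `c`. -/
lemma Gamma_add_two_lt_of_Gamma_add_one_lt {x c : ℝ} (hx : 0 < x)
    (h : Gamma (x + 1) < exp (x * log x - x + log x / 2 + c)) :
    Gamma (x + 1 + 1) < exp ((x + 1) * log (x + 1) - (x + 1) + log (x + 1) / 2 + c) := by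
  have hx1 : 0 < x + 1 := by positivity
  have hlog : 1 ≤ (x + 1 / 2) * (log (x + 1) - log x) := by
    have h₁ := le_log_one_add_of_nonneg (x := 1 / x) (by positivity)
    have h₂ : log (1 + 1 / x) = log (x + 1) - log x := by
      rw [← log_div hx1.ne' hx.ne']
      congr 1
      field_simp
    have h₃ : 2 * (1 / x) / (1 / x + 2) = 1 / (x + 1 / 2) := by
      field_simp
      ring
    rw [h₂, h₃, div_le_iff₀ (by positivity)] at h₁
    linarith
  calc Gamma (x + 1 + 1) = (x + 1) * Gamma (x + 1) := Gamma_add_one hx1.ne'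
    _ < (x + 1) * exp (x * log x - x + log x / 2 + c) := by gcongr
    _ = exp (log (x + 1) + (x * log x - x + log x / 2 + c)) := by
      rw [exp_add (log (x + 1)), exp_log hx1]
    _ ≤ _ := exp_le_exp.2 (by linarith)

/-- A Stirling-type upper bound for the Gamma function at half-integers. -/
lemma Gamma_half_add_one_lt : ∀ n : ℕ, 1 ≤ n →
    Gamma ((n : ℝ) / 2 + 1) < exp ((n : ℝ) / 2 * log ((n : ℝ) / 2) - (n : ℝ) / 2 +
      log ((n : ℝ) / 2) / 2 + log (2.8 * π) / 2)
  | 0, h => by omega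
  | 1, _ => by
    have hlog : log (1 / 2) / 2 + log (1 / 2) / 2 + log (2.8 * π) / 2 - 1 / 2 =
        log (√(0.7 * π / exp 1)) := by
      rw [log_sqrt (by positivity), log_div (x := 0.7 * π) (by positivity) (exp_pos 1).ne', log_exp,
        show (0.7 : ℝ) * π = 1 / 2 * (1 / 2) * (2.8 * π) by ring,
        log_mul (x := 1 / 2 * (1 / 2)) (by norm_num) (by positivity),
        log_mul (x := 1 / 2) (by norm_num) (by norm_num)]
      ring
    have hG : Gamma ((1 : ℝ) / 2 + 1) = √(π / 4) := by
      rw [Gamma_add_one (by norm_num), Gamma_one_half_eq, sqrt_div pi_pos.le,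
        show (4 : ℝ) = 2 ^ 2 by norm_num, sqrt_sq (by norm_num)]
      ring
    rw [Nat.cast_one, hG, show (1 : ℝ) / 2 * log (1 / 2) - 1 / 2 + log (1 / 2) / 2 +
      log (2.8 * π) / 2 = log (√(0.7 * π / exp 1)) by rw [← hlog]; ring, exp_log (by positivity)]
    apply sqrt_lt_sqrt (by positivity)
    rw [div_lt_div_iff₀ (by norm_num) (exp_pos 1)]
    nlinarith [exp_one_lt_d9, pi_pos]
  | 2, _ => by
    have h : (2 : ℝ) < log (2.8 * π) := by
      rw [lt_log_iff_exp_lt (by positivity), show (2 : ℝ) = 1 + 1 by norm_num, exp_add]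
      nlinarith [exp_one_lt_d9, pi_gt_three, exp_pos 1]
    simp only [Nat.cast_ofNat, ne_eq, OfNat.ofNat_ne_zero, not_false_eq_true, div_self, log_one]
    rw [Gamma_add_one one_ne_zero, Gamma_one, mul_one, one_lt_exp_iff]
    linarith
  | n + 3, _ => by
    have h := Gamma_add_two_lt_of_Gamma_add_one_lt (by positivity)
      (Gamma_half_add_one_lt (n + 1) (by omega))
    have e : ((n + 3 : ℕ) : ℝ) / 2 = ((n + 1 : ℕ) : ℝ) / 2 + 1 := by push_cast; ring
    rwa [e]

/-- the volume `β_n` of the unit Euclidean ball in `ℝ^n` satisfies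
`β_n > (2πe/n)^{n/2} · (1.4 π n)^{-1/2}`. -/
theorem unit_ball_volume_lower_bound (n : ℕ) (hn : 1 ≤ n) :
    (2 * π * Real.exp 1 / n) ^ ((n : ℝ) / 2) * (1.4 * π * n) ^ (-(1 : ℝ) / 2) <
      (volume (Metric.closedBall (0 : EuclideanSpace ℝ (Fin n)) 1)).toReal := by
  have : Nonempty (Fin n) := ⟨⟨0, hn⟩⟩
  have hn' : (0 : ℝ) < n := by exact_mod_cast hn
  have hG : 0 < Gamma ((n : ℝ) / 2 + 1) := Gamma_pos_of_pos (by positivity)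
  rw [EuclideanSpace.volume_closedBall, Fintype.card_fin, ENNReal.ofReal_one, one_pow, one_mul,
    ENNReal.toReal_ofReal (by positivity), lt_div_iff₀ hG]
  refine (mul_lt_mul_of_pos_left (Gamma_half_add_one_lt n hn) (by positivity)).trans_eq ?_
  have hpi : √π ^ n = exp (n / 2 * log π) := by
    rw [← exp_log (show 0 < √π ^ n by positivity), log_pow, log_sqrt pi_pos.le]
    ring_nf
  rw [hpi, rpow_def_of_pos (by positivity), rpow_def_of_pos (by positivity), ← exp_add, ← exp_add]
  have h₁ : log (2 * π * exp 1 / n) = log π + 1 - log (n / 2) := by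
    rw [show 2 * π * exp 1 / n = π * exp 1 / (n / 2) by field_simp,
      log_div (by positivity) (by positivity), log_mul (by positivity) (by positivity), log_exp]
  have h₂ : log (1.4 * π * n) = log (2.8 * π) + log (n / 2) := by
    rw [← log_mul (by positivity) (by positivity)]
    ring_nf
  rw [h₁, h₂]
  ring_nf
end

section
/- Let n ≥ 1 and let K be a symmetric positive definite n×n real matrix. Then there exists a nonzero integer vector i ∈ ℤ^n \ {0} such that iᵀ K i < η(n) · (det K)^{1/n}, where η(n) = (2n/(πe)) · (1.4 π n)^{1/n}. -/
open Real Matrix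

lemma exp_two_mul_pow_le (n : ℕ) : exp 1 ^ 2 * (n : ℝ) ^ (n + 1) ≤ ((n : ℝ) + 2) ^ (n + 1) := by
  rcases n.eq_zero_or_pos with rfl | hn
  · norm_num
  have hn' : (0 : ℝ) < n := by exact_mod_cast hn
  have h := Real.le_log_one_add_of_nonneg (x := 2 / (n : ℝ)) (by positivity)
  have h2 : (2 : ℝ) ≤ (n + 1) * Real.log (1 + 2 / n) := by
    have e : 2 * (2 / (n : ℝ)) / (2 / n + 2) = 2 / (n + 1) := by field_simp; ring
    rw [e, div_le_iff₀ (by positivity)] at h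
    linarith
  have h3 : exp 1 ^ 2 ≤ (1 + 2 / (n : ℝ)) ^ (n + 1) := by
    rw [← Real.exp_nat_mul, ← Real.log_le_log_iff (by positivity) (by positivity), Real.log_exp,
      Real.log_pow]
    push_cast
    linarith
  calc exp 1 ^ 2 * (n : ℝ) ^ (n + 1) ≤ (1 + 2 / (n : ℝ)) ^ (n + 1) * (n : ℝ) ^ (n + 1) := by gcongr
    _ = ((n : ℝ) + 2) ^ (n + 1) := by rw [← mul_pow]; congr 1; field_simp

lemma Gamma_half_add_one_sq_lt :
    ∀ n : ℕ, 1 ≤ n → Gamma ((n : ℝ) / 2 + 1) ^ 2 < (n / (2 * exp 1)) ^ n * (1.4 * π * n)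
  | 1, _ => by
    have h := Real.exp_one_lt_d9
    have h0 := Real.exp_pos 1
    have e : Gamma (((1 : ℕ) : ℝ) / 2 + 1) ^ 2 = π / 4 := by
      rw [Real.Gamma_add_one (by norm_num), Nat.cast_one, Real.Gamma_one_half_eq, mul_pow,
        Real.sq_sqrt pi_pos.le]
      ring
    rw [e]
    have : π / 4 * (2 * exp 1) < 1.4 * π := by nlinarith [pi_pos]
    calc π / 4 < 1.4 * π / (2 * exp 1) := by rwa [lt_div_iff₀ (by positivity)]
      _ = _ := by push_cast; ring
  | 2, _ => by
    have h := Real.exp_one_lt_d9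
    have h0 := Real.exp_pos 1
    have e : Gamma (((2 : ℕ) : ℝ) / 2 + 1) ^ 2 = 1 := by
      norm_num [Real.Gamma_two]
    rw [e]
    have : 1 * exp 1 ^ 2 < 2.8 * π := by nlinarith [pi_gt_d2]
    calc (1 : ℝ) < 2.8 * π / exp 1 ^ 2 := by rwa [lt_div_iff₀ (by positivity)]
      _ = _ := by push_cast; field_simp; norm_num
  | n + 3, _ => by
    have ih := Gamma_half_add_one_sq_lt (n + 1) (by lia)
    have hb := exp_two_mul_pow_le (n + 1)
    have e : Gamma (((n + 3 : ℕ) : ℝ) / 2 + 1) =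
        (((n + 1 : ℕ) : ℝ) / 2 + 1) * Gamma (((n + 1 : ℕ) : ℝ) / 2 + 1) := by
      rw [← Real.Gamma_add_one (by positivity)]
      congr 1
      push_cast
      ring
    have c : ((n + 3 : ℕ) : ℝ) = ((n + 1 : ℕ) : ℝ) + 2 := by push_cast; ring
    rw [e, c, mul_pow]
    generalize Gamma (((n + 1 : ℕ) : ℝ) / 2 + 1) = G at *
    have hx : (0 : ℝ) < ((n + 1 : ℕ) : ℝ) := by positivity
    generalize ((n + 1 : ℕ) : ℝ) = x at *
    calc (x / 2 + 1) ^ 2 * G ^ 2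
        < (x / 2 + 1) ^ 2 * ((x / (2 * exp 1)) ^ (n + 1) * (1.4 * π * x)) := by gcongr
      _ = 1.4 * π * (x / 2 + 1) ^ 2 * (exp 1 ^ 2 * x ^ (n + 1 + 1)) /
            (exp 1 ^ 2 * (2 * exp 1) ^ (n + 1)) := by
        rw [div_pow]; field_simp; ring
      _ ≤ 1.4 * π * (x / 2 + 1) ^ 2 * (x + 2) ^ (n + 1 + 1) /
            (exp 1 ^ 2 * (2 * exp 1) ^ (n + 1)) := by gcongr
      _ = _ := by
        rw [div_pow]; field_simp; ring

open scoped MatrixOrder in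
lemma Matrix.PosSemidef.exists_eq_transpose_mul_self {ι : Type*} [Fintype ι] [DecidableEq ι]
    {K : Matrix ι ι ℝ} (hK : K.PosSemidef) : ∃ F : Matrix ι ι ℝ, K = Fᵀ * F := by
  obtain ⟨F, hF⟩ := CStarAlgebra.nonneg_iff_eq_star_mul_self.mp hK.nonneg
  exact ⟨F, by rw [hF, star_eq_conjTranspose, conjTranspose_eq_transpose_of_trivial]⟩

open MeasureTheory in
lemma volume_ellipsoid {ι : Type*} [Fintype ι] [DecidableEq ι] [Nonempty ι]
    {F : Matrix ι ι ℝ} (hF : F.det ≠ 0) (r : ℝ) :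
    volume ((fun x : ι → ℝ => WithLp.toLp 2 (F *ᵥ x)) ⁻¹'
      Metric.ball (0 : EuclideanSpace ℝ ι) r) =
      ENNReal.ofReal |F.det⁻¹| * (ENNReal.ofReal r ^ Fintype.card ι *
        ENNReal.ofReal (√π ^ Fintype.card ι / Gamma (Fintype.card ι / 2 + 1))) := by
  have hF' : LinearMap.det (Matrix.toLin' F) ≠ 0 := by rwa [LinearMap.det_toLin']
  have := Measure.addHaar_preimage_linearMap volume hF'
    ((WithLp.toLp 2 : (ι → ℝ) → EuclideanSpace ℝ ι) ⁻¹' Metric.ball 0 r)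
  rw [(PiLp.volume_preserving_toLp ι).measure_preimage
    Metric.isOpen_ball.measurableSet.nullMeasurableSet, EuclideanSpace.volume_ball,
    LinearMap.det_toLin'] at this
  exact this

open MeasureTheory in
lemma exists_int_ne_zero_mem_of_two_pow_lt_volume {ι : Type*} [Fintype ι] {s : Set (ι → ℝ)}
    (h_symm : ∀ x ∈ s, -x ∈ s) (h_conv : Convex ℝ s) (h : 2 ^ Fintype.card ι < volume s) :
    ∃ i : ι → ℤ, i ≠ 0 ∧ (fun j => (i j : ℝ)) ∈ s := by
  classical
  have : Countable (Submodule.span ℤ (Set.range (Pi.basisFun ℝ ι))).toAddSubgroup :=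
    inferInstanceAs (Countable (Submodule.span ℤ (Set.range (Pi.basisFun ℝ ι))))
  obtain ⟨⟨x, hx⟩, hx0, hxs⟩ := exists_ne_zero_mem_lattice_of_measure_mul_two_pow_lt_measure
    (ZSpan.isAddFundamentalDomain' (Pi.basisFun ℝ ι) volume) h_symm h_conv (by
      have : Matrix.of (Pi.basisFun ℝ ι) = 1 := by
        ext i j; simp [Matrix.one_apply, Pi.single_apply, eq_comm]
      rw [ZSpan.volume_fundamentalDomain, this]
      simpa using h)
  choose i hi using ((Pi.basisFun ℝ ι).mem_span_iff_repr_mem ℤ x).mp hx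
  have hxi : (fun j => (i j : ℝ)) = x := by
    ext j; simpa using hi j
  refine ⟨i, ?_, by rwa [hxi]⟩
  rintro rfl
  exact hx0 (Subtype.ext (by simp [← hxi]; rfl))

/-- for a symmetric positive definite real `n×n` matrix `K` there is a
nonzero integer vector `i` with `iᵀ K i < η(n) · (det K)^{1/n}`, where
`η(n) = (2n/(πe)) · (1.4 π n)^{1/n}`. -/
theorem shortest_vector_quadratic_form_bound
    (n : ℕ) (hn : 1 ≤ n) (K : Matrix (Fin n) (Fin n) ℝ) (hK : K.PosDef) :
    ∃ i : Fin n → ℤ, i ≠ 0 ∧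
      (fun j => (i j : ℝ)) ⬝ᵥ K.mulVec (fun j => (i j : ℝ)) <
        (2 * n / (π * Real.exp 1)) * (1.4 * π * n) ^ ((n : ℝ)⁻¹) * K.det ^ ((n : ℝ)⁻¹) := by
  have hn0 : n ≠ 0 := by lia
  have : Nonempty (Fin n) := ⟨⟨0, hn⟩⟩
  have hn' : (0 : ℝ) < n := by exact_mod_cast hn
  have hdet := hK.det_pos
  obtain ⟨F, hKF⟩ := hK.posSemidef.exists_eq_transpose_mul_self
  have hdetF : K.det = F.det ^ 2 := by rw [hKF, det_mul, det_transpose, sq]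
  have hF : F.det ≠ 0 := by rintro h; simp [hdetF, h] at hdet
  set R := (2 * n / (π * Real.exp 1)) * (1.4 * π * n) ^ ((n : ℝ)⁻¹) * K.det ^ ((n : ℝ)⁻¹) with hR
  have hR0 : 0 < R := by positivity
  have hRn : R ^ n = (2 * n / (π * Real.exp 1)) ^ n * (1.4 * π * n) * F.det ^ 2 := by
    rw [hR, mul_pow, mul_pow, Real.rpow_inv_natCast_pow (by positivity) hn0,
      Real.rpow_inv_natCast_pow hdet.le hn0, hdetF]
  have hG : 0 < Gamma ((n : ℝ) / 2 + 1) := Real.Gamma_pos_of_pos (by positivity)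
  have hvol : 2 ^ n < |F.det⁻¹| * (√R ^ n * (√π ^ n / Gamma ((n : ℝ) / 2 + 1))) := by
    refine lt_of_pow_lt_pow_left₀ 2 (by positivity) ?_
    have e : (|F.det⁻¹| * (√R ^ n * (√π ^ n / Gamma ((n : ℝ) / 2 + 1)))) ^ 2 =
        4 ^ n * ((n / (2 * exp 1)) ^ n * (1.4 * π * n)) / Gamma ((n : ℝ) / 2 + 1) ^ 2 := by
      rw [mul_pow, mul_pow, div_pow, sq_abs, pow_right_comm, pow_right_comm (√π),
        Real.sq_sqrt hR0.le, Real.sq_sqrt pi_pos.le, hRn]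
      have : (4 : ℝ) ^ n * (n / (2 * exp 1)) ^ n = (2 * n / (π * exp 1)) ^ n * π ^ n := by
        rw [← mul_pow, ← mul_pow]
        congr 1
        field_simp
        norm_num
      rw [← mul_assoc (4 ^ n), this]
      field_simp
    rw [e, lt_div_iff₀ (by positivity), pow_right_comm, show (2 : ℝ) ^ 2 = 4 by norm_num]
    exact mul_lt_mul_of_pos_left (Gamma_half_add_one_sq_lt n hn) (by positivity)
  obtain ⟨i, hi0, hi⟩ := exists_int_ne_zero_mem_of_two_pow_lt_volume
    (s := (fun x : Fin n → ℝ => WithLp.toLp 2 (F *ᵥ x)) ⁻¹'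
      Metric.ball (0 : EuclideanSpace ℝ (Fin n)) √R)
    (fun x hx => by
      simpa [mulVec_neg, WithLp.toLp_neg] using hx)
    ((convex_ball _ _).linear_preimage
      ((WithLp.linearEquiv 2 ℝ (Fin n → ℝ)).symm.toLinearMap ∘ₗ Matrix.toLin' F))
    (by
      rw [volume_ellipsoid hF, ← ENNReal.ofReal_pow (by positivity),
        ← ENNReal.ofReal_mul (by positivity), ← ENNReal.ofReal_mul (by positivity),
        Fintype.card_fin, ← ENNReal.ofReal_ofNat, ← ENNReal.ofReal_pow (by positivity)]
      exact (ENNReal.ofReal_lt_ofReal_iff_of_nonneg (by positivity)).mpr hvol)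
  refine ⟨i, hi0, ?_⟩
  rw [Set.mem_preimage, mem_ball_zero_iff, Real.lt_sqrt (norm_nonneg _),
    EuclideanSpace.real_norm_sq_eq] at hi
  rw [hKF, ← mulVec_mulVec, dotProduct_mulVec, vecMul_transpose]
  simpa [dotProduct, sq] using hi
end

section
/- For every real number a with |a| < 1: min( 1/(1 − a²), 2/(1 + |a|) ) ≤ 4/3, with equality if and only if |a| = 1/2; moreover 1/(1 − a²) ≤ 2/(1 + |a|) if and only if |a| ≤ 1/2. -/
/-- for `|a| < 1`, `min(1/(1−a²), 2/(1+|a|)) ≤ 4/3`, with equality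
iff `|a| = 1/2`; moreover `1/(1−a²) ≤ 2/(1+|a|)` iff `|a| ≤ 1/2`. -/
theorem two_tap_optimal_filter_comparison (a : ℝ) (ha : |a| < 1) :
    min (1 / (1 - a ^ 2)) (2 / (1 + |a|)) ≤ 4 / 3 ∧
      (min (1 / (1 - a ^ 2)) (2 / (1 + |a|)) = 4 / 3 ↔ |a| = 1 / 2) ∧
      (1 / (1 - a ^ 2) ≤ 2 / (1 + |a|) ↔ |a| ≤ 1 / 2) := by
  rw [← sq_abs a]
  have h_nonneg := abs_nonneg a
  generalize |a| = x at *
  have h_sq : 0 < 1 - x ^ 2 := by nlinarith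
  have h_add : 0 < 1 + x := by linarith
  have h_iff : 1 / (1 - x ^ 2) ≤ 2 / (1 + x) ↔ x ≤ 1 / 2 := by
    rw [div_le_div_iff₀ h_sq h_add]
    constructor <;> intro h <;> nlinarith
  rcases le_or_gt x (1 / 2) with hx | hx
  · rw [min_eq_left (h_iff.2 hx), div_le_div_iff₀ h_sq (by norm_num),
      div_eq_div_iff h_sq.ne' (by norm_num)]
    refine ⟨by nlinarith, ⟨fun h => by nlinarith, ?_⟩, h_iff⟩
    rintro rfl
    norm_num
  · rw [min_eq_right (not_le.1 (mt h_iff.1 hx.not_ge)).le,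
      div_le_div_iff₀ h_add (by norm_num), div_eq_div_iff h_add.ne' (by norm_num)]
    exact ⟨by linarith, ⟨fun h => by linarith, fun h => by linarith⟩, h_iff⟩
end

section
/- Let R be a commutative ring, let N ≥ n ≥ 1, and let i ∈ R^N be a vector with i_k = 0 for all k ≥ n and with i_0 a unit of R. Then the map x ↦ x ⊛ i (cyclic convolution of length N) is injective on the set of vectors x ∈ R^N satisfying x_k = 0 for all N − (n−1) ≤ k ≤ N − 1. In particular, over R = ℤ_q for any q ≥ 2, a zero-padded transmitted block x can be uniquely reconstructed from x ⊛ i mod q whenever the integer filter I(D) is monic (i_0 = 1), regardless of whether q is prime. -/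
/-- over a commutative ring `R`, cyclic convolution with a filter
`i` supported on the first `n` coordinates whose leading tap `i_0` is a unit is
injective on zero-padded vectors (vectors vanishing on the last `n−1`
coordinates). In particular, over `ℤ_q` a zero-padded block is uniquely
reconstructible from its cyclic convolution with a monic integer filter,
regardless of whether `q` is prime. -/
theorem zero_padded_reconstruction_injective
    (R : Type*) [CommRing R] (N n : ℕ) (hn : 1 ≤ n) (hN : n ≤ N) [NeZero N]
    (i : Fin N → R) (hi : ∀ k : Fin N, n ≤ (k : ℕ) → i k = 0)
    (hunit : IsUnit (i 0)) :
    Set.InjOn (fun x : Fin N → R => fun k : Fin N => ∑ m : Fin N, i m * x (k - m))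
      {x : Fin N → R | ∀ k : Fin N, N - (n - 1) ≤ (k : ℕ) → x k = 0} := by
  intro x hx y hy hxy
  suffices h : ∀ (j : ℕ) (k : Fin N), (k : ℕ) = j → x k = y k from funext fun k => h k k rfl
  intro j
  induction j using Nat.strong_induction_on with
  | _ j ih =>
    intro k hk
    have hsum : ∑ m, i m * x (k - m) = ∑ m, i m * y (k - m) := congrFun hxy k
    have htail : ∑ m ∈ Finset.univ.erase 0, i m * x (k - m) =
        ∑ m ∈ Finset.univ.erase 0, i m * y (k - m) := by
      refine Finset.sum_congr rfl fun m hm => ?_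
      have hm0 : (m : ℕ) ≠ 0 := fun h => Finset.ne_of_mem_erase hm (Fin.ext (by simpa using h))
      by_cases hmn : n ≤ (m : ℕ)
      · rw [hi m hmn, zero_mul, zero_mul]
      · rcases le_or_gt m k with hmk | hmk
        · have hval := Fin.sub_val_of_le hmk
          have hle : (m : ℕ) ≤ k := hmk
          rw [ih _ (by omega) (k - m) rfl]
        · have hval := Fin.coe_sub_iff_lt.mpr hmk
          have hpad : N - (n - 1) ≤ ((k - m : Fin N) : ℕ) := by omega
          rw [hx _ hpad, hy _ hpad]
    rw [← Finset.add_sum_erase _ _ (Finset.mem_univ (0 : Fin N)),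
      ← Finset.add_sum_erase _ _ (Finset.mem_univ (0 : Fin N)), htail] at hsum
    simpa using hunit.mul_left_cancel (add_right_cancel hsum)
end
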